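/- Let ε ∈ [0,1], let γ be a (C0,C1)-elliptic symmetric matrix and let ξ ∈ ℝ^{nN} be nonzero. Then for every η ∈ ℝ^{nN} one has (ε + λ(|ξ|_γ)) |η|²_γ ≤ ℬ_ε(γ,ξ)(η,η) ≤ (ε + Λ(|ξ|_γ)) |η|²_γ. -/

import Mathlib

noncomputable section

open Real

/-- The `γ`-inner product on `ℝ^{nN}`. -/
def gInner {n N : ℕ} (γ : Matrix (Fin n) (Fin n) ℝ) (ξ η : Fin N → Fin n → ℝ) : ℝ :=
  ∑ i, ∑ α, ∑ β, γ α β * ξ i α * η i β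

/-- The `γ`-norm on `ℝ^{nN}`. -/
def gNorm {n N : ℕ} (γ : Matrix (Fin n) (Fin n) ℝ) (ξ : Fin N → Fin n → ℝ) : ℝ :=
  Real.sqrt (gInner γ ξ ξ)

/-- The Euclidean norm on `ℝ^{nN}`. -/
def eNorm {n N : ℕ} (ξ : Fin N → Fin n → ℝ) : ℝ :=
  Real.sqrt (∑ i, ∑ α, ξ i α ^ 2)

/-- A symmetric `(C0, C1)`-elliptic matrix. -/
def IsElliptic {n : ℕ} (C0 C1 : ℝ) (γ : Matrix (Fin n) (Fin n) ℝ) : Prop :=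
  (∀ α β, γ α β = γ β α) ∧
  ∀ ζ : Fin n → ℝ,
    C0 * ∑ α, ζ α ^ 2 ≤ (∑ α, ∑ β, γ α β * ζ α * ζ β) ∧
    (∑ α, ∑ β, γ α β * ζ α * ζ β) ≤ C1 * ∑ α, ζ α ^ 2

/-- `h(t) = (t-1)_+^{p-1} / t` (with the convention `h(0) = 0`). -/
def hfun (p t : ℝ) : ℝ := (max (t - 1) 0) ^ (p - 1) / t

/-- `g(t) = (t-1)_+^p / t`. -/
def gfun (p t : ℝ) : ℝ := (max (t - 1) 0) ^ p / t

/-- The derivative of `h` on `(1,∞)`, extended by `0` elsewhere. -/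
def hderiv (p s : ℝ) : ℝ :=
  if 1 < s then (s - 1) ^ (p - 2) * ((p - 2) * s + 1) / s ^ 2 else 0

/-- The derivative of `g` on `(1,∞)`, extended by `0` elsewhere. -/
def gderiv (p s : ℝ) : ℝ :=
  if 1 < s then (s - 1) ^ (p - 1) * ((p - 1) * s + 1) / s ^ 2 else 0

/-- `λ(t) = min{h(t), (p-1)(t-1)^{p-2}}` for `t > 1`, and `0` for `t ≤ 1`. -/
def lamFun (p t : ℝ) : ℝ :=
  if 1 < t then min (hfun p t) ((p - 1) * (t - 1) ^ (p - 2)) else 0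

/-- `Λ(t) = max{h(t), (p-1)(t-1)^{p-2}}` for `t > 1`, and `0` for `t ≤ 1`. -/
def LamFun (p t : ℝ) : ℝ :=
  if 1 < t then max (hfun p t) ((p - 1) * (t - 1) ^ (p - 2)) else 0

/-- The vector field `A_ε(γ, ξ) = h_ε(|ξ|_γ) ξ` (equal to `0` at `ξ = 0`). -/
def Avf {n N : ℕ} (p ε : ℝ) (γ : Matrix (Fin n) (Fin n) ℝ) (ξ : Fin N → Fin n → ℝ) :
    Fin N → Fin n → ℝ :=
  fun i α => (hfun p (gNorm γ ξ) + ε) * ξ i α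

/-- The map `G_δ(γ, ξ) = ((|ξ|_γ - 1 - δ)_+ / |ξ|_γ) ξ` (equal to `0` at `ξ = 0`). -/
def Gmap {n N : ℕ} (δ : ℝ) (γ : Matrix (Fin n) (Fin n) ℝ) (ξ : Fin N → Fin n → ℝ) :
    Fin N → Fin n → ℝ :=
  fun i α => (max (gNorm γ ξ - 1 - δ) 0) / gNorm γ ξ * ξ i α

/-- The bilinear form `𝒜_ε(γ, ξ)` on third-order tensors in `ℝ^{n²N}`. -/
def Aform {n N : ℕ} (p ε : ℝ) (γ : Matrix (Fin n) (Fin n) ℝ) (ξ : Fin N → Fin n → ℝ)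
    (η ζ : Fin N → Fin n → Fin n → ℝ) : ℝ :=
  ∑ i, ∑ j, ∑ α, ∑ β, ∑ ν, ∑ σ,
    ((hfun p (gNorm γ ξ) + ε) * γ α β * (if i = j then (1 : ℝ) else 0) +
        hderiv p (gNorm γ ξ) / gNorm γ ξ *
          (∑ d, γ α d * ξ i d) * (∑ k, γ β k * ξ j k)) *
      γ ν σ * η i α ν * ζ j β σ

/-- The bilinear form `ℬ_ε(γ, ξ)` on `ℝ^{nN}`. -/
def Bform {n N : ℕ} (p ε : ℝ) (γ : Matrix (Fin n) (Fin n) ℝ) (ξ : Fin N → Fin n → ℝ)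
    (η ζ : Fin N → Fin n → ℝ) : ℝ :=
  ∑ i, ∑ j, ∑ α, ∑ β,
    ((hfun p (gNorm γ ξ) + ε) * γ α β * (if i = j then (1 : ℝ) else 0) +
        hderiv p (gNorm γ ξ) / gNorm γ ξ *
          (∑ d, γ α d * ξ i d) * (∑ k, γ β k * ξ j k)) *
      η i α * ζ j β

/-- The bilinear form `𝒞_ε(γ, ξ)` on `ℝ^n`. -/
def Cform {n N : ℕ} (p ε : ℝ) (γ : Matrix (Fin n) (Fin n) ℝ) (ξ : Fin N → Fin n → ℝ)
    (ζ ζ' : Fin n → ℝ) : ℝ :=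
  ∑ α, ∑ β,
    ((hfun p (gNorm γ ξ) + ε) * γ α β +
        hderiv p (gNorm γ ξ) / gNorm γ ξ *
          (∑ i, (∑ d, γ α d * ξ i d) * (∑ k, γ β k * ξ i k))) *
      ζ α * ζ' β

/-- The squared `γ`-norm of a third-order tensor in `ℝ^{n²N}`. -/
def tNormSq {n N : ℕ} (γ : Matrix (Fin n) (Fin n) ℝ) (η : Fin N → Fin n → Fin n → ℝ) : ℝ :=
  ∑ i, ∑ α, ∑ β, ∑ ν, ∑ σ, γ α β * γ ν σ * η i α ν * η i β σ

theorem gInner_comm {n N : ℕ} {γ : Matrix (Fin n) (Fin n) ℝ} (hγ : ∀ α β, γ α β = γ β α)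
    (ξ η : Fin N → Fin n → ℝ) : gInner γ ξ η = gInner γ η ξ := by
  unfold gInner
  refine Finset.sum_congr rfl fun i _ => ?_
  rw [Finset.sum_comm]
  refine Finset.sum_congr rfl fun α _ => Finset.sum_congr rfl fun β _ => ?_
  rw [hγ β α]
  ring

theorem gInner_sub_left {n N : ℕ} (γ : Matrix (Fin n) (Fin n) ℝ) (ξ ξ' η : Fin N → Fin n → ℝ) :
    gInner γ (ξ - ξ') η = gInner γ ξ η - gInner γ ξ' η := by
  simp only [gInner, ← Finset.sum_sub_distrib, Pi.sub_apply, mul_sub, sub_mul]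

theorem gInner_smul_left {n N : ℕ} (γ : Matrix (Fin n) (Fin n) ℝ) (c : ℝ)
    (ξ η : Fin N → Fin n → ℝ) : gInner γ (c • ξ) η = c * gInner γ ξ η := by
  simp only [gInner, Finset.mul_sum, Pi.smul_apply, smul_eq_mul]
  refine Finset.sum_congr rfl fun i _ => Finset.sum_congr rfl fun α _ =>
    Finset.sum_congr rfl fun β _ => ?_
  ring

theorem gInner_self_nonneg {n N : ℕ} {C0 C1 : ℝ} (hC0 : 0 ≤ C0) {γ : Matrix (Fin n) (Fin n) ℝ}
    (hγ : IsElliptic C0 C1 γ) (ξ : Fin N → Fin n → ℝ) : 0 ≤ gInner γ ξ ξ :=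
  Finset.sum_nonneg fun i _ =>
    (mul_nonneg hC0 (Finset.sum_nonneg fun _ _ => sq_nonneg _)).trans (hγ.2 (ξ i)).1

theorem gNorm_sq {n N : ℕ} {C0 C1 : ℝ} (hC0 : 0 ≤ C0) {γ : Matrix (Fin n) (Fin n) ℝ}
    (hγ : IsElliptic C0 C1 γ) (ξ : Fin N → Fin n → ℝ) : gNorm γ ξ ^ 2 = gInner γ ξ ξ :=
  Real.sq_sqrt (gInner_self_nonneg hC0 hγ ξ)

/-- The Cauchy–Schwarz inequality for the `γ`-inner product, with a nonzero left vector. -/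
theorem gInner_sq_le {n N : ℕ} {C0 C1 : ℝ} (hC0 : 0 ≤ C0) {γ : Matrix (Fin n) (Fin n) ℝ}
    (hγ : IsElliptic C0 C1 γ) {ξ : Fin N → Fin n → ℝ} (hξ : 0 < gInner γ ξ ξ)
    (η : Fin N → Fin n → ℝ) : gInner γ ξ η ^ 2 ≤ gInner γ ξ ξ * gInner γ η η := by
  have h := gInner_self_nonneg hC0 hγ (gInner γ ξ ξ • η - gInner γ ξ η • ξ)
  rw [gInner_sub_left, gInner_smul_left, gInner_smul_left,
    gInner_comm hγ.1 η (_ - _), gInner_comm hγ.1 ξ (_ - _)] at h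
  simp only [gInner_sub_left, gInner_smul_left] at h
  rw [gInner_comm hγ.1 η ξ] at h
  refine sub_nonneg.1 (nonneg_of_mul_nonneg_right (a := gInner γ ξ ξ) ?_ hξ)
  linarith

theorem Bform_self_eq {n N : ℕ} (p ε : ℝ) {γ : Matrix (Fin n) (Fin n) ℝ}
    (hγ : ∀ α β, γ α β = γ β α) (ξ η : Fin N → Fin n → ℝ) :
    Bform p ε γ ξ η η = (hfun p (gNorm γ ξ) + ε) * gInner γ η η +
      hderiv p (gNorm γ ξ) / gNorm γ ξ * gInner γ ξ η ^ 2 := by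
  have hflux : gInner γ ξ η = ∑ i, ∑ α, (∑ d, γ α d * ξ i d) * η i α := by
    rw [gInner_comm hγ]
    simp only [gInner, Finset.sum_mul]
    refine Finset.sum_congr rfl fun i _ => Finset.sum_congr rfl fun α _ =>
      Finset.sum_congr rfl fun β _ => ?_
    ring
  rw [hflux, sq, Finset.sum_mul_sum]
  unfold Bform gInner
  obtain ⟨F, hF⟩ : ∃ F : Fin N → Fin n → ℝ, ∀ i α, ∑ d, γ α d * ξ i d = F i α :=
    ⟨_, fun _ _ => rfl⟩
  simp only [hF]
  generalize hfun p (gNorm γ ξ) + ε = a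
  generalize hderiv p (gNorm γ ξ) / gNorm γ ξ = b
  simp only [Finset.sum_mul_sum, Finset.mul_sum (a := a), Finset.mul_sum (a := b), add_mul,
    Finset.sum_add_distrib]
  congr 1
  · refine Finset.sum_congr rfl fun i _ => ?_
    rw [Finset.sum_eq_single i (fun j _ hj => by simp [Ne.symm hj]) (by simp)]
    refine Finset.sum_congr rfl fun α _ => Finset.sum_congr rfl fun β _ => ?_
    simp only [if_true]
    ring
  · refine Finset.sum_congr rfl fun i _ => Finset.sum_congr rfl fun j _ =>
      Finset.sum_congr rfl fun α _ => Finset.sum_congr rfl fun β _ => ?_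
    ring

theorem hfun_eq_zero {p t : ℝ} (hp : 1 < p) (ht : t ≤ 1) : hfun p t = 0 := by
  rw [hfun, max_eq_right (by linarith), Real.zero_rpow (by linarith), zero_div]

/-- The derivative of `t ↦ t h(t) = (t - 1)^{p - 1}` on `(1,∞)`. -/
theorem hfun_add_mul_hderiv {p t : ℝ} (ht : 1 < t) :
    hfun p t + t * hderiv p t = (p - 1) * (t - 1) ^ (p - 2) := by
  have ht1 : 0 < t - 1 := sub_pos.2 ht
  have ht0 : t ≠ 0 := by linarith
  have hpow : (t - 1) ^ (p - 1) = (t - 1) ^ (p - 2) * (t - 1) := by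
    rw [← Real.rpow_add_one ht1.ne']
    ring_nf
  rw [hfun, hderiv, if_pos ht, max_eq_left ht1.le, hpow]
  field_simp
  ring

/-- Lemma `ellipticity` for the bilinear form `ℬ_ε`. -/
theorem statement10 (n N : ℕ) (hn : 1 ≤ n) (hN : 1 ≤ N) (p C0 C1 : ℝ)
    (hp : 1 < p) (hC0 : 0 < C0) (hC01 : C0 ≤ C1)
    (ε : ℝ) (hε0 : 0 ≤ ε) (hε1 : ε ≤ 1)
    (γ : Matrix (Fin n) (Fin n) ℝ) (hγ : IsElliptic C0 C1 γ)
    (ξ : Fin N → Fin n → ℝ) (hξ : ξ ≠ 0)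
    (η : Fin N → Fin n → ℝ) :
    (ε + lamFun p (gNorm γ ξ)) * gInner γ η η ≤ Bform p ε γ ξ η η ∧
      Bform p ε γ ξ η η ≤ (ε + LamFun p (gNorm γ ξ)) * gInner γ η η := by
  rw [Bform_self_eq p ε hγ.1]
  set t := gNorm γ ξ with ht_def
  rcases le_or_gt t 1 with ht | ht
  · simp [hfun_eq_zero hp ht, hderiv, lamFun, LamFun, not_lt.2 ht]
  · have ht0 : 0 < t := by linarith
    have hsq : t ^ 2 = gInner γ ξ ξ := gNorm_sq hC0.le hγ ξ
    have hcs := gInner_sq_le hC0.le hγ (hsq ▸ pow_pos ht0 2) η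
    rw [← hsq] at hcs
    obtain ⟨θ, hθ⟩ : ∃ θ, gInner γ ξ η ^ 2 = t ^ 2 * θ :=
      ⟨gInner γ ξ η ^ 2 / t ^ 2, by field_simp⟩
    have hθ0 : 0 ≤ θ :=
      nonneg_of_mul_nonneg_right (hθ ▸ sq_nonneg (gInner γ ξ η)) (pow_pos ht0 2)
    have hθ1 : 0 ≤ gInner γ η η - θ :=
      sub_nonneg.2 (le_of_mul_le_mul_left (hθ ▸ hcs) (pow_pos ht0 2))
    have hB : (hfun p t + ε) * gInner γ η η + hderiv p t / t * gInner γ ξ η ^ 2 =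
        ε * gInner γ η η + (hfun p t * (gInner γ η η - θ) +
          (p - 1) * (t - 1) ^ (p - 2) * θ) := by
      rw [hθ, ← hfun_add_mul_hderiv ht]
      field_simp
      ring
    rw [hB, lamFun, LamFun, if_pos ht, if_pos ht]
    generalize (p - 1) * (t - 1) ^ (p - 2) = b
    constructor
    · have h₁ := mul_le_mul_of_nonneg_right (min_le_left (hfun p t) b) hθ1
      have h₂ := mul_le_mul_of_nonneg_right (min_le_right (hfun p t) b) hθ0
      linarith
    · have h₁ := mul_le_mul_of_nonneg_right (le_max_left (hfun p t) b) hθ1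
      have h₂ := mul_le_mul_of_nonneg_right (le_max_right (hfun p t) b) hθ0
      linarith
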